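/- Let (X, ξ) be a probability space and Φ as in the standard entropy setup. Let (f_n) ⊂ P_Φ and f ∈ P_Φ be such that limsup_n α_{f_n}(t) ≤ α_f(t) for all t ≥ 0. Suppose that for some β > 0, ∫_1^∞ t^{−β} Φ''(t) dt < ∞ and sup_n ∫_X f_n^{1+β} dξ < ∞. Then limsup_n ∫_X Φ(f_n) dξ ≤ ∫_X Φ(f) dξ. -/

import Mathlib

open MeasureTheory Filter

noncomputable def alphaFn {X : Type*} [MeasurableSpace X] (ξ : Measure X) (f : X → ℝ) (t : ℝ) : ℝ :=
  ∫ τ in Set.Ioi t, (ξ {x | τ ≤ f x}).toReal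

/-- Layer-cake form of `alphaFn`. -/
theorem alphaFn_eq_integral_max_sub {X : Type*} [MeasurableSpace X] {ξ : Measure X}
    [IsFiniteMeasure ξ] {g : X → ℝ} (hg : Integrable g ξ) (t : ℝ) :
    alphaFn ξ g t = ∫ x, max (g x - t) 0 ∂ξ := by
  have hg_int : Integrable (fun x => max (g x - t) 0) ξ :=
    (hg.sub (integrable_const t)).pos_part
  rw [hg_int.integral_eq_integral_meas_le (Eventually.of_forall fun x => le_max_right _ _), alphaFn,
    ← (measurePreserving_add_right volume t).setIntegral_preimage_emb
      (measurableEmbedding_addRight t)]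
  have hpre : (fun s : ℝ => s + t) ⁻¹' Set.Ioi t = Set.Ioi 0 := by ext; simp
  rw [hpre]
  refine setIntegral_congr_fun measurableSet_Ioi fun s (hs : 0 < s) => ?_
  have hset : {x | s + t ≤ g x} = {x | s ≤ max (g x - t) 0} := by
    ext x
    simp only [Set.mem_ofPred_eq, le_max_iff, le_sub_iff_add_le]
    exact ⟨Or.inl, fun h => h.resolve_right (not_le.2 hs)⟩
  simp only [hset, Measure.real]

theorem alphaFn_nonneg {X : Type*} [MeasurableSpace X] (ξ : Measure X) (g : X → ℝ) (t : ℝ) :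
    0 ≤ alphaFn ξ g t :=
  integral_nonneg fun _ => ENNReal.toReal_nonneg

theorem alphaFn_le_integral {X : Type*} [MeasurableSpace X] {ξ : Measure X}
    [IsFiniteMeasure ξ] {g : X → ℝ} (hg : Integrable g ξ) (hg0 : ∀ x, 0 ≤ g x)
    {t : ℝ} (ht : 0 ≤ t) : alphaFn ξ g t ≤ ∫ x, g x ∂ξ := by
  rw [alphaFn_eq_integral_max_sub hg]
  exact integral_mono (hg.sub (integrable_const t)).pos_part hg
    fun x => max_le (by linarith) (hg0 x)

/-- Markov-type bound on `alphaFn` by a moment of order `1 + β`. -/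
theorem alphaFn_le_rpow_neg_mul {X : Type*} [MeasurableSpace X] {ξ : Measure X}
    [IsFiniteMeasure ξ] {g : X → ℝ} (hg : Integrable g ξ) (hg0 : ∀ x, 0 ≤ g x) {β : ℝ}
    (hβ : 0 < β) (hmom : Integrable (fun x => g x ^ (1 + β)) ξ) {t : ℝ} (ht : 0 < t) :
    alphaFn ξ g t ≤ t ^ (-β) * ∫ x, g x ^ (1 + β) ∂ξ := by
  rw [alphaFn_eq_integral_max_sub hg, ← integral_const_mul]
  refine integral_mono (hg.sub (integrable_const t)).pos_part (hmom.const_mul _) fun x => ?_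
  have hnn : 0 ≤ t ^ (-β) * g x ^ (1 + β) :=
    mul_nonneg (Real.rpow_nonneg ht.le _) (Real.rpow_nonneg (hg0 x) _)
  refine max_le ?_ hnn
  rcases le_total (g x) t with h | h
  · linarith
  · have hgx : 0 < g x := ht.trans_le h
    rw [Real.rpow_add hgx, Real.rpow_one, Real.rpow_neg ht.le]
    have h1 : t ^ β ≤ g x ^ β := Real.rpow_le_rpow ht.le h hβ.le
    have h2 : 0 < t ^ β := Real.rpow_pos_of_pos ht β
    have h3 : g x ≤ (t ^ β)⁻¹ * (g x * g x ^ β) := by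
      rw [inv_mul_eq_div, le_div_iff₀ h2]
      exact mul_le_mul_of_nonneg_left h1 hgx.le
    linarith

theorem ConvexOn.second_deriv_nonneg {Φ Φ' Φ'' : ℝ → ℝ} (hconv : ConvexOn ℝ (Set.Ici 0) Φ)
    (hderiv : ∀ t : ℝ, 0 < t → HasDerivAt Φ (Φ' t) t)
    (hderiv2 : ∀ t : ℝ, 0 < t → HasDerivAt Φ' (Φ'' t) t) {t : ℝ} (ht : 0 < t) : 0 ≤ Φ'' t := by
  have hmono : MonotoneOn Φ' (Set.Ioi 0) := by
    have h := (hconv.subset Set.Ioi_subset_Ici_self (convex_Ioi 0)).monotoneOn_deriv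
      fun x hx => (hderiv x hx).differentiableAt
    exact h.congr fun x hx => (hderiv x hx).deriv
  rw [← (hderiv2 t ht).hasDerivWithinAt.derivWithin (uniqueDiffOn_Ioi (0 : ℝ) t ht)]
  exact hmono.derivWithin_nonneg

/-- A convex function lies above its tangent lines. -/
theorem ConvexOn.tangent_le {S : Set ℝ} {Φ : ℝ → ℝ} (hconv : ConvexOn ℝ S Φ)
    {x y d : ℝ} (hy : y ∈ S) (hx : x ∈ S) (hd : HasDerivAt Φ d y) :
    Φ y + d * (x - y) ≤ Φ x := by
  rcases lt_trichotomy x y with h | rfl | h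
  · have := hconv.slope_le_of_hasDerivAt hx hy h hd
    rw [slope_def_field, div_le_iff₀ (by linarith)] at this
    linarith
  · simp
  · have := hconv.le_slope_of_hasDerivAt hy hx h hd
    rw [slope_def_field, le_div_iff₀ (by linarith)] at this
    linarith

/-- Second order Taylor formula with integral remainder, expressed through the functions
`t ↦ max (x - t) 0`. -/
theorem integral_max_sub_mul_second_deriv {Φ Φ' Φ'' : ℝ → ℝ} {ε : ℝ} (hε : 0 < ε)
    (hderiv : ∀ t : ℝ, 0 < t → HasDerivAt Φ (Φ' t) t)
    (hderiv2 : ∀ t : ℝ, 0 < t → HasDerivAt Φ' (Φ'' t) t)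
    (hcont : ContinuousOn Φ'' (Set.Ioi 0)) (x : ℝ) :
    IntegrableOn (fun t => max (x - t) 0 * Φ'' t) (Set.Ioi ε) ∧
    ∫ t in Set.Ioi ε, max (x - t) 0 * Φ'' t =
      if ε ≤ x then Φ x - Φ ε - Φ' ε * (x - ε) else 0 := by
  have hzero : ∀ t, x < t → max (x - t) 0 * Φ'' t = 0 := fun t ht => by
    rw [max_eq_right (by linarith), zero_mul]
  split_ifs with h
  · have hpos : ∀ t ∈ Set.Icc ε x, 0 < t := fun t ht => hε.trans_le ht.1
    have hc : ContinuousOn (fun t => (x - t) * Φ'' t) (Set.uIcc ε x) := by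
      rw [Set.uIcc_of_le h]
      exact (continuousOn_const.sub continuousOn_id).mul (hcont.mono hpos)
    have hI := hc.intervalIntegrable (μ := volume)
    have hftc := intervalIntegral.integral_eq_sub_of_hasDerivAt
      (f := fun t => (x - t) * Φ' t + Φ t) (fun t ht => by
        rw [Set.uIcc_of_le h] at ht
        have h1 := (((hasDerivAt_id t).const_sub x).mul (hderiv2 t (hpos t ht))).add
          (hderiv t (hpos t ht))
        refine h1.congr_deriv (?_ : _ = (x - t) * Φ'' t)
        simp) hI
    rw [intervalIntegral.integral_of_le h] at hftc
    rw [intervalIntegrable_iff_integrableOn_Ioc_of_le h] at hI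
    have hEq : Set.EqOn (fun t => (x - t) * Φ'' t) (fun t => max (x - t) 0 * Φ'' t)
        (Set.Ioc ε x) := fun t ht => by
      simp only [max_eq_left (sub_nonneg.2 ht.2)]
    have hsub : Set.Ioc ε x ⊆ Set.Ioi ε := fun t ht => ht.1
    have hout : ∀ t ∈ Set.Ioi ε \ Set.Ioc ε x, max (x - t) 0 * Φ'' t = 0 := fun t ht =>
      hzero t (not_le.1 fun hh => ht.2 ⟨ht.1, hh⟩)
    refine ⟨(hI.congr_fun hEq measurableSet_Ioc).of_forall_sdiff_eq_zero measurableSet_Ioi hout, ?_⟩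
    rw [setIntegral_eq_of_subset_of_forall_sdiff_eq_zero measurableSet_Ioi hsub hout,
      ← setIntegral_congr_fun measurableSet_Ioc hEq, hftc]
    ring
  · have hEq : Set.EqOn (fun _ => (0 : ℝ)) (fun t => max (x - t) 0 * Φ'' t) (Set.Ioi ε) :=
      fun t ht => (hzero t ((not_le.1 h).trans ht)).symm
    refine ⟨integrableOn_zero.congr_fun hEq measurableSet_Ioi, ?_⟩
    rw [← setIntegral_congr_fun measurableSet_Ioi hEq, integral_zero]

/-- The integral of the second order Taylor remainder of `Φ` at `ε` along `g`, in terms of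
`alphaFn`. -/
theorem integral_taylor_remainder_eq {X : Type*} [MeasurableSpace X] {ξ : Measure X}
    [IsFiniteMeasure ξ] {Φ Φ' Φ'' : ℝ → ℝ} {ε : ℝ} (hε : 0 < ε)
    (hderiv : ∀ t : ℝ, 0 < t → HasDerivAt Φ (Φ' t) t)
    (hderiv2 : ∀ t : ℝ, 0 < t → HasDerivAt Φ' (Φ'' t) t)
    (hcont : ContinuousOn Φ'' (Set.Ioi 0)) (hnn : ∀ t, 0 < t → 0 ≤ Φ'' t)
    {g : X → ℝ} (hgm : Measurable g) (hg : Integrable g ξ)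
    (hΦg : Integrable (fun x => Φ (g x)) ξ) :
    Integrable (fun x => if ε ≤ g x then Φ (g x) - Φ ε - Φ' ε * (g x - ε) else 0) ξ ∧
    IntegrableOn (fun t => alphaFn ξ g t * Φ'' t) (Set.Ioi ε) ∧
    ∫ x, (if ε ≤ g x then Φ (g x) - Φ ε - Φ' ε * (g x - ε) else 0) ∂ξ =
      ∫ t in Set.Ioi ε, alphaFn ξ g t * Φ'' t := by
  have hpt := integral_max_sub_mul_second_deriv hε hderiv hderiv2 hcont
  have hRint : Integrable
      (fun x => if ε ≤ g x then Φ (g x) - Φ ε - Φ' ε * (g x - ε) else 0) ξ := by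
    have h := ((hΦg.sub (integrable_const (Φ ε))).sub
      ((hg.sub (integrable_const ε)).const_mul (Φ' ε))).indicator
      (measurableSet_le measurable_const hgm : MeasurableSet {x | ε ≤ g x})
    refine h.congr (Eventually.of_forall fun x => ?_)
    simp [Set.indicator_apply]
  have hmeas : AEStronglyMeasurable
      (Function.uncurry fun (x : X) (t : ℝ) => max (g x - t) 0 * Φ'' t)
      (ξ.prod (volume.restrict (Set.Ioi ε))) := by
    have h1 : AEStronglyMeasurable Φ'' (volume.restrict (Set.Ioi ε)) :=
      (hcont.mono (Set.Ioi_subset_Ioi hε.le)).aestronglyMeasurable measurableSet_Ioi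
    have h2 : Measurable fun p : X × ℝ => max (g p.1 - p.2) 0 := by fun_prop
    exact h2.aestronglyMeasurable.mul (h1.comp_snd)
  have hprod : Integrable (Function.uncurry fun (x : X) (t : ℝ) => max (g x - t) 0 * Φ'' t)
      (ξ.prod (volume.restrict (Set.Ioi ε))) := by
    rw [integrable_prod_iff hmeas]
    refine ⟨Eventually.of_forall fun x => (hpt (g x)).1, ?_⟩
    refine hRint.congr (Eventually.of_forall fun x => ?_)
    simp only [Function.uncurry_apply_pair]
    rw [← (hpt (g x)).2]
    refine setIntegral_congr_fun measurableSet_Ioi fun t ht => ?_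
    exact (Real.norm_of_nonneg (mul_nonneg (le_max_right _ _) (hnn t (hε.trans ht)))).symm
  have halpha : ∀ t, ∫ x, max (g x - t) 0 * Φ'' t ∂ξ = alphaFn ξ g t * Φ'' t := fun t => by
    rw [integral_mul_const, alphaFn_eq_integral_max_sub hg]
  refine ⟨hRint, ?_, ?_⟩
  · have h := hprod.integral_prod_right
    simp only [Function.uncurry_apply_pair, halpha] at h
    exact h
  · have h := integral_integral_swap hprod
    simp only [halpha, (hpt _).2] at h
    exact h

/-- For `Φ` convex with `Φ 0 = 0`, replacing `Φ` by its chord on `[0, ε]` gives two-sided bounds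
for `∫ Φ ∘ g` in terms of `alphaFn ξ g`. -/
theorem integral_convex_comp_bounds {X : Type*} [MeasurableSpace X] {ξ : Measure X}
    [IsProbabilityMeasure ξ] {Φ Φ' Φ'' : ℝ → ℝ}
    (hconv : ConvexOn ℝ (Set.Ici 0) Φ) (hΦ0 : Φ 0 = 0) (hΦ1 : Φ 1 = 0)
    (hderiv : ∀ t : ℝ, 0 < t → HasDerivAt Φ (Φ' t) t)
    (hderiv2 : ∀ t : ℝ, 0 < t → HasDerivAt Φ' (Φ'' t) t)
    (hcont : ContinuousOn Φ'' (Set.Ioi 0)) {g : X → ℝ} (hgm : Measurable g)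
    (hg0 : ∀ x, 0 ≤ g x) (hg : Integrable g ξ) (hg1 : ∫ x, g x ∂ξ = 1)
    (hΦg : Integrable (fun x => Φ (g x)) ξ) {ε : ℝ} (hε : 0 < ε) (hε1 : ε < 1) :
    IntegrableOn (fun t => alphaFn ξ g t * Φ'' t) (Set.Ioi ε) ∧
    ∫ x, Φ (g x) ∂ξ ≤ Φ ε / ε + (Φ' ε - Φ ε / ε) * alphaFn ξ g ε
      + ∫ t in Set.Ioi ε, alphaFn ξ g t * Φ'' t ∧
    Φ ε / ε + (Φ' ε - Φ ε / ε) * alphaFn ξ g ε + ∫ t in Set.Ioi ε, alphaFn ξ g t * Φ'' t ≤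
      ∫ x, Φ (g x) ∂ξ + Φ' 1 * ξ.real {x | 0 < g x ∧ g x < ε} := by
  obtain ⟨hR, hA, hEq⟩ := integral_taylor_remainder_eq hε hderiv hderiv2 hcont
    (fun t ht => hconv.second_deriv_nonneg hderiv hderiv2 ht) hgm hg hΦg
  set R : X → ℝ := fun x => if ε ≤ g x then Φ (g x) - Φ ε - Φ' ε * (g x - ε) else 0
  have hm : Integrable (fun x => max (g x - ε) 0) ξ := (hg.sub (integrable_const ε)).pos_part
  have hlin : Integrable (fun x => Φ ε / ε * g x + (Φ' ε - Φ ε / ε) * max (g x - ε) 0) ξ :=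
    (hg.const_mul _).add (hm.const_mul _)
  have hΨ : Integrable (fun x => Φ ε / ε * g x + (Φ' ε - Φ ε / ε) * max (g x - ε) 0 + R x) ξ :=
    hlin.add hR
  have hΨint : ∫ x, (Φ ε / ε * g x + (Φ' ε - Φ ε / ε) * max (g x - ε) 0 + R x) ∂ξ =
      Φ ε / ε + (Φ' ε - Φ ε / ε) * alphaFn ξ g ε + ∫ t in Set.Ioi ε, alphaFn ξ g t * Φ'' t := by
    rw [integral_add hlin hR,
      integral_add (hg.const_mul _) (hm.const_mul _), integral_const_mul, integral_const_mul,
      hg1, hEq, alphaFn_eq_integral_max_sub hg, mul_one]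
  have hchord : ∀ y, 0 ≤ y → y ≤ ε → Φ y ≤ Φ ε / ε * y := fun y hy hyε => by
    have h := hconv.2 (Set.mem_Ici.2 le_rfl) (Set.mem_Ici.2 hε.le)
      (sub_nonneg.2 ((div_le_one hε).2 hyε)) (div_nonneg hy hε.le) (by ring)
    simp only [smul_eq_mul, mul_zero, zero_add, hΦ0, div_mul_cancel₀ y hε.ne'] at h
    exact h.trans_eq (by ring)
  have hΦε : Φ ε ≤ 0 := by
    have h := hconv.2 (Set.mem_Ici.2 le_rfl) (Set.mem_Ici.2 zero_le_one)
      (sub_nonneg.2 hε1.le) hε.le (by ring)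
    simpa [hΦ0, hΦ1] using h
  have hset : MeasurableSet {x | 0 < g x ∧ g x < ε} :=
    (measurableSet_lt measurable_const hgm).inter (measurableSet_lt hgm measurable_const)
  have habove : ∀ x, ε ≤ g x →
      Φ ε / ε * g x + (Φ' ε - Φ ε / ε) * max (g x - ε) 0 + R x = Φ (g x) := fun x hx => by
    simp only [R, if_pos hx, max_eq_left (sub_nonneg.2 hx)]
    field_simp
    ring
  have hbelow : ∀ x, g x < ε →
      Φ ε / ε * g x + (Φ' ε - Φ ε / ε) * max (g x - ε) 0 + R x = Φ ε / ε * g x := fun x hx => by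
    simp only [R, if_neg (not_le.2 hx), max_eq_right (sub_nonpos.2 hx.le)]
    ring
  refine ⟨hA, ?_, ?_⟩
  · rw [← hΨint]
    refine integral_mono hΦg hΨ fun x => ?_
    rcases le_or_gt ε (g x) with h | h
    · exact (habove x h).ge
    · exact (hchord _ (hg0 x) h.le).trans_eq (hbelow x h).symm
  · have hI : Integrable ({x | 0 < g x ∧ g x < ε}.indicator fun _ => Φ' 1) ξ :=
      (integrable_const _).indicator hset
    have hIint : ∫ x, {x | 0 < g x ∧ g x < ε}.indicator (fun _ => Φ' 1) x ∂ξ =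
        Φ' 1 * ξ.real {x | 0 < g x ∧ g x < ε} := by
      rw [integral_indicator_const _ hset, smul_eq_mul, mul_comm]
    rw [← hΨint, ← hIint, ← integral_add hΦg hI]
    refine integral_mono hΨ (hΦg.add hI) fun x => ?_
    rcases le_or_gt ε (g x) with h | h
    · simp only [habove x h, Set.indicator_apply, Set.mem_ofPred_eq, not_lt.2 h, and_false,
        if_false, add_zero, le_refl]
    · simp only [hbelow x h]
      rcases (hg0 x).eq_or_lt with h0 | h0
      · simp [← h0, hΦ0]
      · have hx : x ∈ {x | 0 < g x ∧ g x < ε} := ⟨h0, h⟩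
        rw [Set.indicator_of_mem hx]
        have htan := hconv.tangent_le (Set.mem_Ici.2 zero_le_one) (Set.mem_Ici.2 h0.le)
          (hderiv 1 one_pos)
        have hslope := hconv.tangent_le (Set.mem_Ici.2 zero_le_one) (Set.mem_Ici.2 le_rfl)
          (hderiv 1 one_pos)
        rw [hΦ1] at htan hslope
        rw [hΦ0] at hslope
        have h1 : Φ ε / ε * g x ≤ 0 :=
          mul_nonpos_of_nonpos_of_nonneg (div_nonpos_of_nonpos_of_nonneg hΦε hε.le) h0.le
        nlinarith

/-- The mass of the region where `g` is positive but small tends to zero. -/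
theorem tendsto_measureReal_pos_lt {X : Type*} [MeasurableSpace X] (ξ : Measure X)
    [IsFiniteMeasure ξ] {g : X → ℝ} (hgm : Measurable g) :
    Tendsto (fun ε : ℝ => ξ.real {x | 0 < g x ∧ g x < ε}) (nhdsWithin 0 (Set.Ioi 0)) (nhds 0) := by
  have h := tendsto_measure_biInter_gt (μ := ξ) (s := fun ε : ℝ => {x | 0 < g x ∧ g x < ε})
    (a := 0) (fun r _ => ((measurableSet_lt measurable_const hgm).inter
      (measurableSet_lt hgm measurable_const)).nullMeasurableSet)
    (fun i j _ hij x hx => ⟨hx.1, hx.2.trans_le hij⟩) ⟨1, one_pos, measure_ne_top _ _⟩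
  have hempty : ⋂ r : ℝ, ⋂ (_ : r > 0), {x | 0 < g x ∧ g x < r} = ∅ := by
    ext x
    simp only [Set.mem_iInter, Set.mem_ofPred_eq, Set.mem_empty_iff_false, iff_false]
    intro hx
    exact lt_irrefl _ (hx _ (hx 1 one_pos).1).2
  rw [hempty, measure_empty] at h
  exact (ENNReal.tendsto_toReal ENNReal.zero_ne_top).comp h

theorem stmt17 {X : Type*} [MeasurableSpace X] (ξ : Measure X) [IsProbabilityMeasure ξ]
    (Φ Φ' Φ'' : ℝ → ℝ) (t₀ : ℝ) (ht₀0 : 0 < t₀) (ht₀1 : t₀ < 1)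
    (hconv : ConvexOn ℝ (Set.Ici 0) Φ)
    (hΦ0 : Φ 0 = 0) (hΦ1 : Φ 1 = 0)
    (hderiv : ∀ t : ℝ, 0 < t → HasDerivAt Φ (Φ' t) t)
    (hderiv2 : ∀ t : ℝ, 0 < t → HasDerivAt Φ' (Φ'' t) t)
    (hcont : ContinuousOn Φ'' (Set.Ioi 0))
    (hlim0 : Tendsto (fun t => t * Φ' t) (nhdsWithin 0 (Set.Ioi 0)) (nhds 0))
    (hneg : ∀ t : ℝ, 0 < t → t < t₀ → Φ' t < 0)
    (hpos : ∀ t : ℝ, t₀ < t → 0 < Φ' t)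
    (fs : ℕ → X → ℝ) (hfsm : ∀ n, Measurable (fs n)) (hfs0 : ∀ n x, 0 ≤ fs n x)
    (hfs1 : ∀ n, ∫ x, fs n x ∂ξ = 1)
    (hΦfs : ∀ n, Integrable (fun x => Φ (fs n x)) ξ)
    (hfslim : ∀ n, Tendsto (fun t => alphaFn ξ (fs n) t * Φ' t) atTop (nhds 0))
    (f : X → ℝ) (hfm : Measurable f) (hf0 : ∀ x, 0 ≤ f x)
    (hf1 : ∫ x, f x ∂ξ = 1)
    (hΦf : Integrable (fun x => Φ (f x)) ξ)
    (hflim : Tendsto (fun t => alphaFn ξ f t * Φ' t) atTop (nhds 0))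
    (hupper : ∀ t : ℝ, 0 ≤ t → limsup (fun n => alphaFn ξ (fs n) t) atTop ≤ alphaFn ξ f t)
    (β : ℝ) (hβ : 0 < β)
    (hΦ''int : IntegrableOn (fun t => t ^ (-β) * Φ'' t) (Set.Ioi (1 : ℝ)))
    (hmom : ∀ n, Integrable (fun x => fs n x ^ (1 + β)) ξ)
    (hmombdd : ∃ C : ℝ, ∀ n, ∫ x, fs n x ^ (1 + β) ∂ξ ≤ C) :
    limsup (fun n => ∫ x, Φ (fs n x) ∂ξ) atTop ≤ ∫ x, Φ (f x) ∂ξ := by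
  obtain ⟨C, hC⟩ := hmombdd
  have hg_int : ∀ {g : X → ℝ}, ∫ x, g x ∂ξ = 1 → Integrable g ξ := fun hg =>
    Integrable.of_integral_ne_zero (hg.trans_ne one_ne_zero)
  have hfsi : ∀ n, Integrable (fs n) ξ := fun n => hg_int (hfs1 n)
  have hfi : Integrable f ξ := hg_int hf1
  have hnn : ∀ t, 0 < t → 0 ≤ Φ'' t := fun t ht => hconv.second_deriv_nonneg hderiv hderiv2 ht
  have hα1 : ∀ n t, 0 ≤ t → alphaFn ξ (fs n) t ≤ 1 := fun n t ht =>
    (alphaFn_le_integral (hfsi n) (hfs0 n) ht).trans_eq (hfs1 n)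
  have hlower : ∀ n, 0 ≤ ∫ x, Φ (fs n x) ∂ξ := fun n => by
    have hlin : ∫ x, Φ' 1 * (fs n x - 1) ∂ξ = 0 := by
      rw [integral_const_mul, integral_sub (hfsi n) (integrable_const 1), hfs1 n]
      simp
    rw [← hlin]
    refine integral_mono (((hfsi n).sub (integrable_const 1)).const_mul _) (hΦfs n) fun x => ?_
    have htan := hconv.tangent_le (Set.mem_Ici.2 zero_le_one) (Set.mem_Ici.2 (hfs0 n x))
      (hderiv 1 one_pos)
    simpa [hΦ1] using htan
  have hexcess : ∀ t, 0 < t → Tendsto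
      (fun n => max (alphaFn ξ (fs n) t - alphaFn ξ f t) 0) atTop (nhds 0) := fun t ht => by
    refine tendsto_order.2 ⟨fun a ha => Eventually.of_forall fun n => ha.trans_le (le_max_right _ _),
      fun a ha => ?_⟩
    have hlt : limsup (fun n => alphaFn ξ (fs n) t) atTop < alphaFn ξ f t + a :=
      (hupper t ht.le).trans_lt (by linarith)
    have hbdd : IsBoundedUnder (· ≤ ·) atTop fun n => alphaFn ξ (fs n) t :=
      isBoundedUnder_of ⟨1, fun n => hα1 n t ht.le⟩
    filter_upwards [eventually_lt_of_limsup_lt hlt hbdd] with n hn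
    exact max_lt (by linarith) ha
  have hmain : ∀ ε, 0 < ε → ε < 1 → limsup (fun n => ∫ x, Φ (fs n x) ∂ξ) atTop ≤
      ∫ x, Φ (f x) ∂ξ + Φ' 1 * ξ.real {x | 0 < f x ∧ f x < ε} := by
    intro ε hε hε1
    have hB := fun n => integral_convex_comp_bounds hconv hΦ0 hΦ1 hderiv hderiv2 hcont
      (hfsm n) (hfs0 n) (hfsi n) (hfs1 n) (hΦfs n) hε hε1
    obtain ⟨hfA, -, hf_le⟩ := integral_convex_comp_bounds hconv hΦ0 hΦ1 hderiv hderiv2 hcont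
      hfm hf0 hfi hf1 hΦf hε hε1
    set h : ℕ → ℝ → ℝ := fun n t => max (alphaFn ξ (fs n) t * Φ'' t - alphaFn ξ f t * Φ'' t) 0
    have hhint : ∀ n, IntegrableOn (h n) (Set.Ioi ε) := fun n => ((hB n).1.sub hfA).pos_part
    have hdom : IntegrableOn (fun t => if t ≤ 1 then Φ'' t else C * (t ^ (-β) * Φ'' t))
        (Set.Ioi ε) := by
      rw [← Set.Ioc_union_Ioi_eq_Ioi hε1.le]
      refine IntegrableOn.union ?_ ?_
      · have hc : IntegrableOn Φ'' (Set.Ioc ε 1) :=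
          ((hcont.mono fun t ht => hε.trans_le ht.1).integrableOn_Icc
            (a := ε) (b := 1)).mono_set Set.Ioc_subset_Icc_self
        exact hc.congr_fun (fun t ht => (if_pos ht.2).symm) measurableSet_Ioc
      · have hc : IntegrableOn (fun t => C * (t ^ (-β) * Φ'' t)) (Set.Ioi 1) :=
          hΦ''int.const_mul C
        exact hc.congr_fun (fun t ht => (if_neg (not_le.2 ht)).symm) measurableSet_Ioi
    have hhlim : Tendsto (fun n => ∫ t in Set.Ioi ε, h n t) atTop (nhds 0) := by
      rw [← integral_zero ℝ ℝ (μ := volume.restrict (Set.Ioi ε))]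
      refine tendsto_integral_of_dominated_convergence _ (fun n => (hhint n).aestronglyMeasurable)
        hdom (fun n => ?_) ?_
      · refine (ae_restrict_iff' measurableSet_Ioi).2 (Eventually.of_forall fun t ht => ?_)
        have ht0 : 0 < t := hε.trans ht
        have hαf := mul_nonneg (alphaFn_nonneg ξ f t) (hnn t ht0)
        have hαn := mul_nonneg (alphaFn_nonneg ξ (fs n) t) (hnn t ht0)
        rw [Real.norm_of_nonneg (le_max_right _ _)]
        refine (max_le (sub_le_self _ hαf) hαn).trans ?_
        split_ifs with h1
        · exact mul_le_of_le_one_left (hnn t ht0) (hα1 n t ht0.le)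
        · rw [← mul_assoc]
          refine mul_le_mul_of_nonneg_right ?_ (hnn t ht0)
          refine (alphaFn_le_rpow_neg_mul (hfsi n) (hfs0 n) hβ (hmom n) ht0).trans ?_
          rw [mul_comm C]
          exact mul_le_mul_of_nonneg_left (hC n) (Real.rpow_nonneg ht0.le _)
      · refine (ae_restrict_iff' measurableSet_Ioi).2 (Eventually.of_forall fun t ht => ?_)
        have ht0 : 0 < t := hε.trans ht
        have hl := (hexcess t ht0).mul_const (Φ'' t)
        rw [zero_mul] at hl
        refine hl.congr fun n => ?_
        simp only [h]
        rw [max_mul_of_nonneg _ _ (hnn t ht0), sub_mul, zero_mul]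
    have hslope : 0 ≤ Φ' ε - Φ ε / ε := by
      have htan := hconv.tangent_le (Set.mem_Ici.2 hε.le) (Set.mem_Ici.2 le_rfl) (hderiv ε hε)
      rw [hΦ0] at htan
      rw [sub_nonneg, div_le_iff₀ hε]
      linarith
    have hupp : ∀ n, ∫ x, Φ (fs n x) ∂ξ ≤
        (∫ x, Φ (f x) ∂ξ + Φ' 1 * ξ.real {x | 0 < f x ∧ f x < ε}) +
        ((Φ' ε - Φ ε / ε) * max (alphaFn ξ (fs n) ε - alphaFn ξ f ε) 0 +
          ∫ t in Set.Ioi ε, h n t) := fun n => by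
      have h1 : ∫ t in Set.Ioi ε, alphaFn ξ (fs n) t * Φ'' t ≤
          (∫ t in Set.Ioi ε, alphaFn ξ f t * Φ'' t) + ∫ t in Set.Ioi ε, h n t := by
        rw [← integral_add hfA (hhint n)]
        refine integral_mono (hB n).1 (hfA.add (hhint n)) fun t => ?_
        have := le_max_left (alphaFn ξ (fs n) t * Φ'' t - alphaFn ξ f t * Φ'' t) 0
        simp only [h]
        linarith
      have h2 := mul_le_mul_of_nonneg_left
        (le_max_left (alphaFn ξ (fs n) ε - alphaFn ξ f ε) 0) hslope
      have h3 := (hB n).2.1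
      linarith
    have herr := ((hexcess ε hε).const_mul (Φ' ε - Φ ε / ε)).add hhlim
    rw [mul_zero, add_zero] at herr
    refine le_of_forall_pos_le_add fun δ hδ => ?_
    refine limsup_le_of_le (isCoboundedUnder_le_of_le atTop hlower) ?_
    filter_upwards [herr.eventually_lt_const hδ] with n hn
    linarith [hupp n]
  have hlim := ((tendsto_measureReal_pos_lt ξ hfm).const_mul (Φ' 1)).const_add (∫ x, Φ (f x) ∂ξ)
  rw [mul_zero, add_zero] at hlim
  refine ge_of_tendsto hlim ?_
  filter_upwards [Ioo_mem_nhdsGT (zero_lt_one' ℝ)] with ε hε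
  exact hmain ε hε.1 hε.2
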